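/- arXiv:1012.1019 — 2 statements merged into one kernel-verified Lean document; each statement's English description precedes it below -/
import Mathlib

section
/- Let H_1,…,H_k ∈ M_{2N}(ℂ) be pairwise commuting matrices, each of which is Hermitian and self-dual. Then there exist a symplectic unitary matrix U ∈ M_{2N}(ℂ) and real diagonal N×N matrices Λ_1,…,Λ_k such that for every r, U† H_r U is the block-diagonal matrix [[Λ_r, 0],[0, Λ_r]]. In particular each eigenvalue of H_r occurs with even multiplicity. -/
open Matrix
open scoped Kronecker ComplexOrder

/-- The 2N×2N matrix `Z = [[0, -I],[I, 0]]`. -/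
noncomputable def Zmat (N : ℕ) : Matrix (Fin N ⊕ Fin N) (Fin N ⊕ Fin N) ℂ :=
  Matrix.fromBlocks 0 (-1) 1 0

/-- The dual `X♯ = -Z Xᵀ Z` of a 2N×2N complex matrix. -/
noncomputable def dual {N : ℕ} (X : Matrix (Fin N ⊕ Fin N) (Fin N ⊕ Fin N) ℂ) :
    Matrix (Fin N ⊕ Fin N) (Fin N ⊕ Fin N) ℂ :=
  -(Zmat N) * Xᵀ * (Zmat N)

lemma exists_common_aux {E : Type*} [AddCommGroup E] [Module ℂ E] [FiniteDimensional ℂ E]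
    {k : ℕ} (f : Fin k → Module.End ℂ E) (hc : ∀ r s x, f r (f s x) = f s (f r x))
    (W : Submodule ℂ E) (hW : W ≠ ⊥) (hinv : ∀ r, ∀ x ∈ W, f r x ∈ W) (s : Finset (Fin k)) :
    ∃ W' : Submodule ℂ E, W' ≠ ⊥ ∧ W' ≤ W ∧ (∀ r, ∀ x ∈ W', f r x ∈ W') ∧
      ∃ μ : Fin k → ℂ, ∀ r ∈ s, ∀ x ∈ W', f r x = μ r • x := by
  classical
  induction s using Finset.induction_on with
  | empty => exact ⟨W, hW, le_rfl, hinv, 0, by simp⟩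
  | insert a s ha ih =>
    obtain ⟨W', h0, hle, hi, μ, hμ⟩ := ih
    have : Nontrivial W' := Submodule.nontrivial_iff_ne_bot.mpr h0
    obtain ⟨c, hcE⟩ := Module.End.exists_eigenvalue ((f a).restrict (hi a))
    obtain ⟨v, hv⟩ := hcE.exists_hasEigenvector
    have hv1 : f a v = c • (v : E) := by
      have := congrArg Subtype.val hv.apply_eq_smul
      simpa using this
    have hv0 : (v : E) ≠ 0 := by simpa using hv.2
    refine ⟨W' ⊓ Module.End.eigenspace (f a) c, ?_, inf_le_left.trans hle, ?_,
      Function.update μ a c, ?_⟩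
    · intro hb
      have : (v : E) ∈ W' ⊓ Module.End.eigenspace (f a) c :=
        ⟨v.2, Module.End.mem_eigenspace_iff.mpr hv1⟩
      rw [hb] at this
      exact hv0 (by simpa using this)
    · rintro r x ⟨hx, hx2⟩
      refine ⟨hi r x hx, ?_⟩
      have hx2 := Module.End.mem_eigenspace_iff.mp hx2
      apply Module.End.mem_eigenspace_iff.mpr
      rw [hc, hx2, map_smul]
    · rintro r hr x ⟨hx, hx2⟩
      have hx2 := Module.End.mem_eigenspace_iff.mp hx2
      by_cases hra : r = a
      · subst hra; simpa using hx2
      · rw [Function.update_of_ne hra]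
        exact hμ r (Finset.mem_of_mem_insert_of_ne hr hra) x hx

lemma Zmat_transpose (N : ℕ) : (Zmat N)ᵀ = -Zmat N := by
  simp [Zmat, Matrix.fromBlocks_transpose, Matrix.fromBlocks_neg]

lemma Zmat_sq (N : ℕ) : Zmat N * Zmat N = -1 := by
  rw [← Matrix.fromBlocks_one, Zmat, Matrix.fromBlocks_multiply, Matrix.fromBlocks_neg]
  simp

lemma Zmat_map_star (N : ℕ) : (Zmat N).map star = Zmat N := by
  ext i j
  rcases i with i | i <;> rcases j with j | j <;> simp [Zmat, Matrix.one_apply]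

/-- `Z H = Hᵀ Z` for self-dual `H`. -/
lemma Zmat_mul_of_dual {N : ℕ} {X : Matrix (Fin N ⊕ Fin N) (Fin N ⊕ Fin N) ℂ}
    (h : dual X = X) : Zmat N * X = Xᵀ * Zmat N := by
  conv_lhs => rw [← h, dual]
  rw [← Matrix.mul_assoc, ← Matrix.mul_assoc, Matrix.mul_neg, Zmat_sq]
  simp

lemma dot_Z_antisymm {N : ℕ} (v w : Fin N ⊕ Fin N → ℂ) :
    v ⬝ᵥ (Zmat N *ᵥ w) = -(w ⬝ᵥ (Zmat N *ᵥ v)) := by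
  rw [Matrix.dotProduct_mulVec, ← Matrix.mulVec_transpose, Zmat_transpose, Matrix.neg_mulVec,
    neg_dotProduct, dotProduct_comm]

lemma exists_family (N k : ℕ)
    (H : Fin k → Matrix (Fin N ⊕ Fin N) (Fin N ⊕ Fin N) ℂ)
    (hcomm : ∀ r s, H r * H s = H s * H r)
    (hherm : ∀ r, (H r)ᴴ = H r)
    (hdual : ∀ r, dual (H r) = H r) (m : ℕ) (hm : m ≤ N) :
    ∃ v : Fin m → (Fin N ⊕ Fin N → ℂ), ∃ Λ : Fin k → Fin m → ℝ,
      (∀ i j, star (v i) ⬝ᵥ v j = if i = j then 1 else 0) ∧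
      (∀ i j, v i ⬝ᵥ (Zmat N *ᵥ v j) = 0) ∧
      ∀ r i, H r *ᵥ v i = (Λ r i : ℂ) • v i := by
  induction m with
  | zero => exact ⟨fun i => i.elim0, fun _ i => i.elim0, fun i => i.elim0, fun i => i.elim0,
      fun _ i => i.elim0⟩
  | succ m ih =>
    obtain ⟨v, Λ, ho, hz, he⟩ := ih (by omega)
    -- the orthogonality map
    let M : Matrix (Fin m ⊕ Fin m) (Fin N ⊕ Fin N) ℂ :=
      Matrix.of (Sum.elim (fun i => star (v i)) (fun i => v i ᵥ* Zmat N))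
    have hmem : ∀ w, w ∈ LinearMap.ker M.mulVecLin ↔
        (∀ i, star (v i) ⬝ᵥ w = 0) ∧ (∀ i, v i ⬝ᵥ (Zmat N *ᵥ w) = 0) := by
      intro w
      simp only [LinearMap.mem_ker, Matrix.mulVecLin_apply, funext_iff, Sum.forall,
        Matrix.dotProduct_mulVec]
      rfl
    have hne : LinearMap.ker M.mulVecLin ≠ ⊥ := by
      apply LinearMap.ker_ne_bot_of_finrank_lt
      simp
      omega
    have hinv : ∀ r, ∀ x ∈ LinearMap.ker M.mulVecLin,
        (H r).mulVecLin x ∈ LinearMap.ker M.mulVecLin := by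
      intro r x hx
      rw [hmem] at hx ⊢
      simp only [Matrix.mulVecLin_apply]
      constructor
      · intro i
        have h1 : star (v i) ᵥ* H r = star (H r *ᵥ v i) := by
          rw [Matrix.star_mulVec, hherm]
        rw [Matrix.dotProduct_mulVec, h1, he, star_smul, smul_dotProduct, hx.1 i, smul_zero]
      · intro i
        rw [Matrix.mulVec_mulVec, Zmat_mul_of_dual (hdual r), ← Matrix.mulVec_mulVec,
          Matrix.dotProduct_mulVec, Matrix.vecMul_transpose, he, smul_dotProduct, hx.2 i,
          smul_zero]
    obtain ⟨W', h0, hle, -, μ, hμ⟩ := exists_common_aux (fun r => (H r).mulVecLin)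
      (by intro r s x; simp [Matrix.mulVec_mulVec, hcomm r s]) _ hne hinv Finset.univ
    obtain ⟨w, hwW, hw0⟩ := (Submodule.ne_bot_iff _).mp h0
    obtain ⟨hw1, hw2⟩ := (hmem w).mp (hle hwW)
    have hwe : ∀ r, H r *ᵥ w = μ r • w := fun r => by simpa using hμ r (Finset.mem_univ _) w hwW
    have hpos : star w ⬝ᵥ w ≠ 0 := by simpa [dotProduct_star_self_eq_zero] using hw0
    have hreal : ∀ r, ((μ r).re : ℂ) = μ r := by
      intro r
      apply Complex.conj_eq_iff_re.mp
      have h1 : star (H r *ᵥ w) ⬝ᵥ w = star w ⬝ᵥ (H r *ᵥ w) := by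
        rw [Matrix.star_mulVec, hherm, Matrix.dotProduct_mulVec]
      rw [hwe, star_smul, smul_dotProduct, dotProduct_smul, smul_eq_mul, smul_eq_mul] at h1
      exact mul_right_cancel₀ hpos h1
    obtain ⟨c, hc0, hc⟩ : ∃ c : ℝ, 0 < c ∧ star w ⬝ᵥ w = (c : ℂ) := by
      have hp : 0 < star w ⬝ᵥ w := by
        simpa using hw0
      refine ⟨(star w ⬝ᵥ w).re, (Complex.pos_iff.mp hp).1, ?_⟩
      apply Complex.ext <;> simp [(Complex.pos_iff.mp hp).2.symm]
    let d : ℂ := (((Real.sqrt c)⁻¹ : ℝ) : ℂ)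
    have hd : d * (star d * c) = 1 := by
      have : (Real.sqrt c)⁻¹ * ((Real.sqrt c)⁻¹ * c) = 1 := by
        have := Real.sq_sqrt hc0.le
        have h2 := Real.sqrt_pos.mpr hc0
        field_simp
        linarith
      have h3 : star d = d := Complex.conj_ofReal _
      rw [h3]
      have h4 := congrArg (fun t : ℝ => (t : ℂ)) this
      simpa [d] using h4
    refine ⟨Fin.snoc v (d • w), fun r => Fin.snoc (Λ r) (μ r).re, ?_, ?_, ?_⟩
    · intro i j
      induction i using Fin.lastCases with
      | last =>
        induction j using Fin.lastCases with
        | last => simp only [Fin.snoc_last, star_smul, smul_dotProduct, dotProduct_smul, hc,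
            smul_eq_mul, hd, if_true]
        | cast j =>
          have : star w ⬝ᵥ v j = 0 := by
            have h5 := congrArg star (hw1 j)
            rw [Matrix.star_dotProduct, star_star, star_zero] at h5
            exact h5
          rw [if_neg (Fin.castSucc_lt_last j).ne']
          simp [star_smul, this]
      | cast i =>
        induction j using Fin.lastCases with
        | last =>
          rw [if_neg (Fin.castSucc_lt_last i).ne]
          simp [hw1]
        | cast j => simp [ho]
    · intro i j
      induction i using Fin.lastCases with
      | last =>
        induction j using Fin.lastCases with
        | last =>
          have := dot_Z_antisymm w w
          have : w ⬝ᵥ (Zmat N *ᵥ w) = 0 := self_eq_neg.mp this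
          simp [Matrix.mulVec_smul, this]
        | cast j =>
          have := dot_Z_antisymm w (v j)
          simp [this, hw2]
      | cast i =>
        induction j using Fin.lastCases with
        | last => simp [Matrix.mulVec_smul, hw2]
        | cast j => simp [hz]
    · intro r i
      induction i using Fin.lastCases with
      | last => simp only [Fin.snoc_last, Matrix.mulVec_smul, hwe, hreal]; exact smul_comm _ _ _
      | cast i => simp [he]

/-- structured spectral theorem — a commuting family of self-dual Hermitian
matrices in `M_{2N}(ℂ)` is simultaneously diagonalized by a symplectic unitary, with
diagonal of the doubled form `[[Λ_r, 0],[0, Λ_r]]` for real diagonal `Λ_r`. -/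
theorem selfdual_spectral_theorem (N k : ℕ)
    (H : Fin k → Matrix (Fin N ⊕ Fin N) (Fin N ⊕ Fin N) ℂ)
    (hcomm : ∀ r s, H r * H s = H s * H r)
    (hherm : ∀ r, (H r)ᴴ = H r)
    (hdual : ∀ r, dual (H r) = H r) :
    ∃ U : Matrix (Fin N ⊕ Fin N) (Fin N ⊕ Fin N) ℂ,
      Uᴴ * U = 1 ∧ Uᵀ * Zmat N * U = Zmat N ∧
      ∃ Λ : Fin k → Fin N → ℝ, ∀ r,
        Uᴴ * H r * U =
          Matrix.fromBlocks (Matrix.diagonal fun i => ((Λ r i : ℝ) : ℂ)) 0 0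
            (Matrix.diagonal fun i => ((Λ r i : ℝ) : ℂ)) := by
  obtain ⟨v, Λ, ho, hz, he⟩ := exists_family N k H hcomm hherm hdual N le_rfl
  let u : Fin N ⊕ Fin N → (Fin N ⊕ Fin N → ℂ) :=
    Sum.elim v (fun i => Zmat N *ᵥ star (v i))
  let U : Matrix (Fin N ⊕ Fin N) (Fin N ⊕ Fin N) ℂ := (Matrix.of u)ᵀ
  have hstarZ : ∀ x : Fin N ⊕ Fin N → ℂ, star (Zmat N *ᵥ x) = Zmat N *ᵥ star x := by
    intro x
    conv_rhs => rw [← Zmat_map_star]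
    ext i
    simp [Matrix.mulVec, dotProduct]
  have hZZ : ∀ x : Fin N ⊕ Fin N → ℂ, Zmat N *ᵥ (Zmat N *ᵥ x) = -x := by
    intro x; rw [Matrix.mulVec_mulVec, Zmat_sq, Matrix.neg_mulVec, Matrix.one_mulVec]
  have hstar : ∀ x y : Fin N ⊕ Fin N → ℂ, star x ⬝ᵥ star y = star (x ⬝ᵥ y) := by
    intro x y; simp [dotProduct]
  have hzs : ∀ i j, star (v i) ⬝ᵥ (Zmat N *ᵥ star (v j)) = 0 := by
    intro i j; rw [← hstarZ, hstar, hz, star_zero]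
  have ho' : ∀ i j, v i ⬝ᵥ star (v j) = if i = j then 1 else 0 := by
    intro i j; rw [dotProduct_comm, ho]; simp [eq_comm]
  have hZd : ∀ x y : Fin N ⊕ Fin N → ℂ, (Zmat N *ᵥ x) ⬝ᵥ y = -(x ⬝ᵥ (Zmat N *ᵥ y)) := by
    intro x y; rw [dotProduct_comm, dot_Z_antisymm]
  have hUU : Uᴴ * U = 1 := by
    ext a b
    have : (Uᴴ * U) a b = star (u a) ⬝ᵥ u b := by
      simp [Matrix.mul_apply, dotProduct, U]
    rw [this]
    rcases a with a | a <;> rcases b with b | b <;>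
      simp [u, hstarZ, hZd, hZZ, ho, ho', hz, hzs, Matrix.one_apply]
  have hHU : ∀ r, H r * U = U *
      Matrix.fromBlocks (Matrix.diagonal fun i => ((Λ r i : ℝ) : ℂ)) 0 0
            (Matrix.diagonal fun i => ((Λ r i : ℝ) : ℂ)) := by
    intro r
    have hHZ : ∀ x : Fin N ⊕ Fin N → ℂ,
        H r *ᵥ (Zmat N *ᵥ star x) = Zmat N *ᵥ star (H r *ᵥ x) := by
      intro x
      have h1 : H r * Zmat N = Zmat N * (H r)ᵀ := by
        conv_lhs => rw [← hdual r, dual]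
        rw [Matrix.mul_assoc, Zmat_sq]
        simp
      rw [Matrix.star_mulVec, hherm, ← Matrix.mulVec_transpose, Matrix.mulVec_mulVec,
        Matrix.mulVec_mulVec, h1]
    ext a b
    rw [Matrix.fromBlocks_diagonal, Matrix.mul_diagonal]
    change (H r *ᵥ u b) a = u b a * _
    rcases b with b | b
    · simp [u, he, mul_comm]
    · simp only [u, Sum.elim_inr]
      rw [hHZ, he, star_smul, Matrix.mulVec_smul]
      simp [mul_comm]
  refine ⟨U, hUU, ?_, Λ, ?_⟩
  · ext a b
    have : (Uᵀ * Zmat N * U) a b = u a ⬝ᵥ (Zmat N *ᵥ u b) := by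
      rw [Matrix.mul_assoc]
      rfl
    rw [this]
    have e11 : ∀ a b, Zmat N (Sum.inl a) (Sum.inl b) = 0 := fun a b => by simp [Zmat]
    have e22 : ∀ a b, Zmat N (Sum.inr a) (Sum.inr b) = 0 := fun a b => by simp [Zmat]
    have e12 : ∀ a b, Zmat N (Sum.inl a) (Sum.inr b) = -if a = b then 1 else 0 :=
      fun a b => by simp [Zmat, Matrix.one_apply]
    have e21 : ∀ a b, Zmat N (Sum.inr a) (Sum.inl b) = if a = b then 1 else 0 :=
      fun a b => by simp [Zmat, Matrix.one_apply]
    rcases a with a | a <;> rcases b with b | b <;>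
      simp only [u, Sum.elim_inl, Sum.elim_inr, hZd, hZZ, ho, ho', hz, hzs, e11, e12, e21, e22,
        dotProduct_neg, Matrix.mulVec_neg, neg_neg, neg_zero]
  · intro r
    rw [Matrix.mul_assoc, hHU, ← Matrix.mul_assoc, hUU, Matrix.one_mul]
end

section
/- Let X ∈ M_{2N}(ℂ) be the block matrix [[A, C],[0, D]] with N×N blocks A, C, D. If X is self-dual and ‖X†X − I‖ ≤ δ for some δ ≥ 0, then D = Aᵀ, ‖A†A − I‖ ≤ δ, and ‖C‖ ≤ √(2δ). -/
open Matrix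
open scoped ComplexOrder

/-- The ℓ²→ℓ² operator norm of a complex matrix. -/
noncomputable def opNorm {n : Type*} [Fintype n] [DecidableEq n] (A : Matrix n n ℂ) : ℝ :=
  ‖Matrix.toEuclideanCLM (𝕜 := ℂ) (n := n) A‖

open scoped Matrix.Norms.L2Operator in
theorem opNorm_eq_l2 {n : Type*} [Fintype n] [DecidableEq n] (A : Matrix n n ℂ) :
    opNorm A = ‖A‖ := rfl

open scoped Matrix.Norms.L2Operator in
theorem norm_one_le_aux (N : ℕ) : ‖(1 : Matrix (Fin N) (Fin N) ℂ)‖ ≤ 1 := by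
  rw [← opNorm_eq_l2, opNorm, map_one]
  exact ContinuousLinearMap.norm_id_le

open scoped Matrix.Norms.L2Operator in
theorem norm_compress {n : Type*} [Fintype n] [DecidableEq n] (N : ℕ)
    (E : Matrix n (Fin N) ℂ) (hE : Eᴴ * E = 1) (M : Matrix n n ℂ) :
    ‖Eᴴ * M * E‖ ≤ ‖M‖ := by
  have h1 : ‖E‖ * ‖E‖ ≤ 1 := by
    rw [← Matrix.l2_opNorm_conjTranspose_mul_self, hE]
    exact norm_one_le_aux N
  calc ‖Eᴴ * M * E‖ ≤ ‖Eᴴ * M‖ * ‖E‖ := Matrix.l2_opNorm_mul _ _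
    _ ≤ (‖Eᴴ‖ * ‖M‖) * ‖E‖ := by gcongr; exact Matrix.l2_opNorm_mul _ _
    _ = (‖E‖ * ‖E‖) * ‖M‖ := by rw [Matrix.l2_opNorm_conjTranspose]; ring
    _ ≤ 1 * ‖M‖ := by gcongr
    _ = ‖M‖ := one_mul _

open scoped Matrix.Norms.L2Operator in
theorem norm_block11 (N : ℕ) (P Q R S : Matrix (Fin N) (Fin N) ℂ) :
    ‖P‖ ≤ ‖Matrix.fromBlocks P Q R S‖ := by
  have h := norm_compress N (Matrix.fromRows (1 : Matrix (Fin N) (Fin N) ℂ) (0 : Matrix (Fin N) (Fin N) ℂ))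
    (by simp [Matrix.conjTranspose_fromRows_eq_fromCols_conjTranspose, Matrix.fromCols_mul_fromRows])
    (Matrix.fromBlocks P Q R S)
  simpa [Matrix.conjTranspose_fromRows_eq_fromCols_conjTranspose, Matrix.fromCols_mul_fromRows,
    Matrix.fromCols_mul_fromBlocks] using h

open scoped Matrix.Norms.L2Operator in
theorem norm_block22 (N : ℕ) (P Q R S : Matrix (Fin N) (Fin N) ℂ) :
    ‖S‖ ≤ ‖Matrix.fromBlocks P Q R S‖ := by
  have h := norm_compress N (Matrix.fromRows (0 : Matrix (Fin N) (Fin N) ℂ) (1 : Matrix (Fin N) (Fin N) ℂ))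
    (by simp [Matrix.conjTranspose_fromRows_eq_fromCols_conjTranspose, Matrix.fromCols_mul_fromRows])
    (Matrix.fromBlocks P Q R S)
  simpa [Matrix.conjTranspose_fromRows_eq_fromCols_conjTranspose, Matrix.fromCols_mul_fromRows,
    Matrix.fromCols_mul_fromBlocks] using h

open scoped Matrix.Norms.L2Operator in
theorem norm_transpose_aux (N : ℕ) (A : Matrix (Fin N) (Fin N) ℂ) :
    ‖(Aᵀ)ᴴ * Aᵀ - 1‖ = ‖Aᴴ * A - 1‖ := by
  have hc : ((Aᵀ)ᴴ * Aᵀ).charpoly = (Aᴴ * A).charpoly := by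
    have : (Aᵀ)ᴴ * Aᵀ = (A * Aᴴ)ᵀ := by
      rw [Matrix.transpose_mul]; rfl
    rw [this, Matrix.charpoly_transpose, Matrix.charpoly_mul_comm]
  have hs : spectrum ℂ ((Aᵀ)ᴴ * Aᵀ) = spectrum ℂ (Aᴴ * A) := by
    ext z
    rw [Matrix.mem_spectrum_iff_isRoot_charpoly, Matrix.mem_spectrum_iff_isRoot_charpoly, hc]
  have hs1 : spectrum ℂ ((Aᵀ)ᴴ * Aᵀ - 1) = spectrum ℂ (Aᴴ * A - 1) := by
    have e : (1 : Matrix (Fin N) (Fin N) ℂ) = algebraMap ℂ _ 1 := by simp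
    rw [e, ← spectrum.sub_singleton_eq, ← spectrum.sub_singleton_eq, hs]
  have sa : ∀ B : Matrix (Fin N) (Fin N) ℂ, IsSelfAdjoint (Bᴴ * B - 1) := fun B =>
    (IsSelfAdjoint.star_mul_self B).sub (IsSelfAdjoint.one _)
  have r1 := (sa Aᵀ).spectralRadius_eq_nnnorm
  have r2 := (sa A).spectralRadius_eq_nnnorm
  unfold spectralRadius at r1 r2
  rw [hs1, r2] at r1
  have := ENNReal.coe_injective r1
  exact (congrArg NNReal.toReal this).symm

open scoped Matrix.Norms.L2Operator in
theorem aux_main (N : ℕ) (A C D : Matrix (Fin N) (Fin N) ℂ)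
    (δ : ℝ) (hδ : 0 ≤ δ)
    (hdual : dual (Matrix.fromBlocks A C 0 D) = Matrix.fromBlocks A C 0 D)
    (hnorm : opNorm ((Matrix.fromBlocks A C 0 D)ᴴ * Matrix.fromBlocks A C 0 D - 1) ≤ δ) :
    D = Aᵀ ∧ opNorm (Aᴴ * A - 1) ≤ δ ∧ opNorm C ≤ Real.sqrt (2 * δ) := by
  have hD : D = Aᵀ := by
    have h := hdual
    simp only [dual, Zmat, Matrix.fromBlocks_transpose, Matrix.fromBlocks_neg,
      Matrix.fromBlocks_multiply] at h
    have := (Matrix.fromBlocks_inj.1 h).2.2.2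
    simpa using this.symm
  have hX : (Matrix.fromBlocks A C 0 D)ᴴ * Matrix.fromBlocks A C 0 D - 1
      = Matrix.fromBlocks (Aᴴ * A - 1) (Aᴴ * C) (Cᴴ * A) (Cᴴ * C + Dᴴ * D - 1) := by
    rw [← Matrix.fromBlocks_one, Matrix.fromBlocks_conjTranspose, Matrix.fromBlocks_multiply,
      sub_eq_add_neg, Matrix.fromBlocks_neg, Matrix.fromBlocks_add]
    simp [sub_eq_add_neg]
  rw [hX, opNorm_eq_l2] at hnorm
  have h1 := (norm_block11 N _ _ _ _).trans hnorm
  have h2 := (norm_block22 N _ _ _ _).trans hnorm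
  refine ⟨hD, h1, ?_⟩
  have h3 : ‖Dᴴ * D - 1‖ ≤ δ := by
    rw [hD, norm_transpose_aux]; exact h1
  rw [opNorm_eq_l2]
  apply Real.le_sqrt_of_sq_le
  rw [sq, ← Matrix.l2_opNorm_conjTranspose_mul_self]
  have e : Cᴴ * C = (Cᴴ * C + Dᴴ * D - 1) - (Dᴴ * D - 1) := by abel
  rw [e]
  exact (norm_sub_le _ _).trans (by linarith)

/-- if the block upper-triangular matrix `X = [[A, C],[0, D]]` is self-dual
and `‖X†X - I‖ ≤ δ`, then `D = Aᵀ`, `‖A†A - I‖ ≤ δ` and `‖C‖ ≤ √(2δ)`. -/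
theorem selfdual_almost_unitary_block_triangular (N : ℕ) (A C D : Matrix (Fin N) (Fin N) ℂ)
    (δ : ℝ) (hδ : 0 ≤ δ)
    (hdual : dual (Matrix.fromBlocks A C 0 D) = Matrix.fromBlocks A C 0 D)
    (hnorm : opNorm ((Matrix.fromBlocks A C 0 D)ᴴ * Matrix.fromBlocks A C 0 D - 1) ≤ δ) :
    D = Aᵀ ∧ opNorm (Aᴴ * A - 1) ≤ δ ∧ opNorm C ≤ Real.sqrt (2 * δ) := by
  exact aux_main N A C D δ hδ hdual hnorm
end
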